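/- arXiv:1605.02920 — 2 statements merged into one kernel-verified Lean document; each statement's English description precedes it below -/
import Mathlib

section
/- Let Q_i(x₁,…,x₅) = x₁^i + x₂^i + x₃^i + x₄^i + x₅^i and let P = 1 + (917/500)Q₁ − (281/50)Q₁² − (41/25)Q₂ + (287/100)Q₁³ + (191/100)Q₁Q₂ − (81/250)Q₃. Define F : ℝ⁵ → ℝ by F(x) = P(x) if x₁,…,x₅ ≥ 0 and x₁+⋯+x₅ ≤ 1, and F(x) = 0 otherwise. Then I₅(F) = ∫_{[0,1]⁵} F(x)² dx = 1735763/1732500000, and for each m ∈ {1,…,5}, J₅^{(m)}(F) = ∫_{[0,1]⁴} (∫_0^1 F(x) dx_m)² (dx_i)_{i≠m} = 722755717/1871100000000. -/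
open scoped Classical
open MeasureTheory

/-- The unit box `[0,1]^k`. -/
def unitBox (k : ℕ) : Set (Fin k → ℝ) := Set.univ.pi fun _ => Set.Icc (0 : ℝ) 1

/-- The power sums `Q_i(x₁,…,x₅) = x₁^i + ⋯ + x₅^i`. -/
noncomputable def Qpow (i : ℕ) (x : Fin 5 → ℝ) : ℝ := ∑ j, x j ^ i

/-- The polynomial `P` from the proof of Theorem 1.4. -/
noncomputable def Ppoly (x : Fin 5 → ℝ) : ℝ :=
  1 + 917 / 500 * Qpow 1 x - 281 / 50 * Qpow 1 x ^ 2 - 41 / 25 * Qpow 2 x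
    + 287 / 100 * Qpow 1 x ^ 3 + 191 / 100 * Qpow 1 x * Qpow 2 x - 81 / 250 * Qpow 3 x

/-- The test function `F`, equal to `P` on the simplex and `0` elsewhere. -/
noncomputable def F5 (x : Fin 5 → ℝ) : ℝ :=
  if (∀ i, 0 ≤ x i) ∧ (∑ i, x i) ≤ 1 then Ppoly x else 0

open scoped Nat in
/-- The Euler beta integral at natural exponents, on an interval of length `r`. -/
theorem integral_pow_mul_sub_pow (r : ℝ) (a b : ℕ) :
    ∫ x in (0 : ℝ)..r, x ^ a * (r - x) ^ b = a ! * b ! / (a + b + 1)! * r ^ (a + b + 1) := by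
  induction a generalizing b with
  | zero =>
    have h := intervalIntegral.integral_comp_sub_left (a := 0) (b := r) (fun x : ℝ => x ^ b) r
    simp only [pow_zero, one_mul, h, sub_self, sub_zero, integral_pow, zero_add, Nat.factorial_zero,
      Nat.factorial_succ]
    push_cast
    have : (b ! : ℝ) ≠ 0 := by positivity
    field_simp
    simp
  | succ a ih =>
    have hu : ∀ x ∈ Set.uIcc 0 r,
        HasDerivAt (fun x : ℝ => x ^ (a + 1)) ((a + 1 : ℕ) * x ^ a) x := fun x _ => by
      simpa using hasDerivAt_pow (a + 1) x
    have hv : ∀ x ∈ Set.uIcc 0 r,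
        HasDerivAt (fun x : ℝ => -(r - x) ^ (b + 1) / (b + 1 : ℕ)) ((r - x) ^ b) x := fun x _ => by
      have h := ((((hasDerivAt_id x).const_sub r).pow (b + 1)).neg).div_const ((b + 1 : ℕ) : ℝ)
      refine h.congr_deriv ?_
      have : (b : ℝ) + 1 ≠ 0 := by positivity
      simp only [id, Nat.add_sub_cancel]
      push_cast
      field_simp
    rw [intervalIntegral.integral_mul_deriv_eq_deriv_mul hu hv
      (Continuous.intervalIntegrable (by fun_prop) _ _)
      (Continuous.intervalIntegrable (by fun_prop) _ _)]
    have h : ∀ x : ℝ, ((a + 1 : ℕ) : ℝ) * x ^ a * (-(r - x) ^ (b + 1) / (b + 1 : ℕ))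
        = -((a + 1) / (b + 1)) * (x ^ a * (r - x) ^ (b + 1)) := fun x => by
      push_cast
      ring
    simp only [h, intervalIntegral.integral_const_mul, ih]
    rw [show a + 1 + b + 1 = a + (b + 1) + 1 by ring, Nat.factorial_succ a, Nat.factorial_succ b]
    push_cast
    have : (b : ℝ) + 1 ≠ 0 := by positivity
    simp
    field_simp

/-- The corner simplex `{x ∈ [0,∞)^n : x₁ + ⋯ + xₙ ≤ r}`. -/
def cornerSimplex (n : ℕ) (r : ℝ) : Set (Fin n → ℝ) := {x | (∀ i, 0 ≤ x i) ∧ ∑ i, x i ≤ r}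

theorem insertNth_mem_cornerSimplex {n : ℕ} {r : ℝ} (m : Fin (n + 1)) (t : ℝ) (y : Fin n → ℝ) :
    (m.insertNth t y : Fin (n + 1) → ℝ) ∈ cornerSimplex (n + 1) r ↔
      0 ≤ t ∧ y ∈ cornerSimplex n (r - t) := by
  simp only [cornerSimplex, Set.mem_ofPred_eq, Fin.forall_iff_succAbove m,
    Fin.sum_univ_succAbove _ m, Fin.insertNth_apply_same, Fin.insertNth_apply_succAbove, and_assoc,
    le_sub_iff_add_le']

theorem cornerSimplex_subset_pi_Icc (n : ℕ) (r : ℝ) :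
    cornerSimplex n r ⊆ Set.univ.pi fun _ => Set.Icc 0 r := fun _ hx i _ =>
  ⟨hx.1 i, (Finset.single_le_sum (fun j _ => hx.1 j) (Finset.mem_univ i)).trans hx.2⟩

theorem isCompact_cornerSimplex (n : ℕ) (r : ℝ) : IsCompact (cornerSimplex n r) := by
  refine (isCompact_univ_pi fun _ => isCompact_Icc).of_isClosed_subset ?_
    (cornerSimplex_subset_pi_Icc n r)
  have h : cornerSimplex n r =
      (⋂ i : Fin n, {x | 0 ≤ x i}) ∩ {x : Fin n → ℝ | ∑ i, x i ≤ r} := by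
    ext
    simp [cornerSimplex]
  rw [h]
  exact (isClosed_iInter fun i => isClosed_le continuous_const (continuous_apply i)).inter
    (isClosed_le (continuous_finsetSum _ fun i _ => continuous_apply i) continuous_const)

theorem measurableSet_cornerSimplex (n : ℕ) (r : ℝ) : MeasurableSet (cornerSimplex n r) :=
  (isCompact_cornerSimplex n r).measurableSet

theorem integral_fin_succ {n : ℕ} {g : (Fin (n + 1) → ℝ) → ℝ} (hg : Integrable g) :
    ∫ x, g x = ∫ t : ℝ, ∫ y : Fin n → ℝ, g ((0 : Fin (n + 1)).insertNth t y) := by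
  have hmp := (volume_preserving_piFinSuccAbove (fun _ : Fin (n + 1) => ℝ) 0).symm
  rw [← hmp.integral_comp' g]
  exact integral_prod _ ((hmp.integrable_comp_emb (MeasurableEquiv.measurableEmbedding _)).2 hg)

open scoped Nat in
/-- Dirichlet's integral over the corner simplex at natural exponents. -/
theorem integral_cornerSimplex_prod_pow (n : ℕ) (a : Fin n → ℕ) (b : ℕ) {r : ℝ} (hr : 0 ≤ r) :
    ∫ x in cornerSimplex n r, (∏ i, x i ^ a i) * (r - ∑ i, x i) ^ b =
      (∏ i, (a i)! : ℕ) * b ! / (n + ∑ i, a i + b)! * r ^ (n + ∑ i, a i + b) := by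
  induction n generalizing r with
  | zero =>
    have h : cornerSimplex 0 r = Set.univ := by ext; simp [cornerSimplex, hr]
    have hb : (b ! : ℝ) ≠ 0 := by positivity
    simp [h, hb, integral_unique, Measure.real, volume_pi]
  | succ n ih =>
    have hint : IntegrableOn (fun x : Fin (n + 1) → ℝ => (∏ i, x i ^ a i) * (r - ∑ i, x i) ^ b)
        (cornerSimplex (n + 1) r) :=
      ContinuousOn.integrableOn_compact (isCompact_cornerSimplex _ _) (by fun_prop)
    rw [← integral_indicator (measurableSet_cornerSimplex _ _),
      integral_fin_succ (hint.integrable_indicator (measurableSet_cornerSimplex _ _))]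
    set N := n + ∑ i : Fin n, a i.succ + b with hN
    set C : ℝ := (∏ i : Fin n, (a i.succ)! : ℕ) * b ! / N ! with hC
    have hslice : ∀ t : ℝ, (∫ y : Fin n → ℝ, (cornerSimplex (n + 1) r).indicator
        (fun x => (∏ i, x i ^ a i) * (r - ∑ i, x i) ^ b) ((0 : Fin (n + 1)).insertNth t y)) =
        (Set.Icc 0 r).indicator (fun t => C * (t ^ a 0 * (r - t) ^ N)) t := fun t => by
      by_cases ht : t ∈ Set.Icc 0 r
      · have h : ∀ y : Fin n → ℝ, (cornerSimplex (n + 1) r).indicator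
            (fun x => (∏ i, x i ^ a i) * (r - ∑ i, x i) ^ b) ((0 : Fin (n + 1)).insertNth t y) =
            (cornerSimplex n (r - t)).indicator (fun y => t ^ a 0 *
              ((∏ i, y i ^ a i.succ) * (r - t - ∑ i, y i) ^ b)) y := fun y => by
          simp only [Set.indicator_apply, insertNth_mem_cornerSimplex, ht.1, true_and]
          simp only [Fin.prod_univ_succ, Fin.sum_univ_succ, Fin.insertNth_zero', Fin.cons_zero,
            Fin.cons_succ, sub_sub, mul_assoc]
        simp only [h]
        rw [integral_indicator (measurableSet_cornerSimplex _ _), integral_const_mul,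
          ih _ (sub_nonneg.2 ht.2), Set.indicator_of_mem ht]
        ring
      · rw [Set.indicator_of_notMem ht]
        refine integral_eq_zero_of_ae (Filter.Eventually.of_forall fun y => ?_)
        refine Set.indicator_of_notMem (fun h => ht ?_) _
        rw [insertNth_mem_cornerSimplex] at h
        exact ⟨h.1, sub_nonneg.1 ((Finset.sum_nonneg fun i _ => h.2.1 i).trans h.2.2)⟩
    simp only [hslice]
    rw [integral_indicator measurableSet_Icc, integral_Icc_eq_integral_Ioc,
      ← intervalIntegral.integral_of_le hr, intervalIntegral.integral_const_mul,
      integral_pow_mul_sub_pow, Fin.prod_univ_succ, Fin.sum_univ_succ,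
      show n + 1 + (a 0 + ∑ i : Fin n, a i.succ) + b = a 0 + N + 1 by rw [hN]; ring, hC]
    have : (N ! : ℝ) ≠ 0 := by positivity
    push_cast
    field_simp

/-- The power sum `x₁^i + ⋯ + xₙ^i`. -/
noncomputable def powerSum {n : ℕ} (i : ℕ) (x : Fin n → ℝ) : ℝ := ∑ k, x k ^ i

/-- The value of the integral of `powerSum i x * powerSum j x * (1 - powerSum 1 x) ^ b` over the
unit corner simplex. -/
noncomputable def powerSumMoment (n i j b : ℕ) : ℝ :=
  (n * (i + j).factorial + n * (n - 1) * (i.factorial * j.factorial)) * b.factorial /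
    (n + (i + j) + b).factorial

open scoped Nat in
theorem integral_cornerSimplex_pow_mul_pow (n : ℕ) (k l : Fin n) (i j b : ℕ) :
    ∫ x in cornerSimplex n 1, x k ^ i * x l ^ j * (1 - ∑ i, x i) ^ b =
      (if k = l then ((i + j)! : ℝ) else i ! * j !) * b ! / (n + (i + j) + b)! := by
  have h := integral_cornerSimplex_prod_pow n (Pi.single k i + Pi.single l j) b zero_le_one
  have hp : ∀ x : Fin n → ℝ,
      ∏ m, x m ^ (Pi.single k i + Pi.single l j : Fin n → ℕ) m = x k ^ i * x l ^ j := fun x => by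
    simp only [Pi.add_apply, pow_add, Finset.prod_mul_distrib, Pi.single_apply, pow_ite, pow_zero,
      Finset.prod_ite_eq', Finset.mem_univ, if_true]
  have hf : ∏ m, ((Pi.single k i + Pi.single l j : Fin n → ℕ) m)! =
      if k = l then (i + j)! else i ! * j ! := by
    split_ifs with hkl
    · subst hkl
      rw [← Pi.single_add, Finset.prod_eq_single k] <;> simp +contextual
    · rw [Finset.prod_eq_mul k l hkl] <;> simp +contextual [hkl, Ne.symm hkl]
  have hs : ∑ m, (Pi.single k i + Pi.single l j : Fin n → ℕ) m = i + j := by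
    simp [Finset.sum_add_distrib]
  simp only [hp, hf, hs, one_pow, mul_one] at h
  rw [h]
  push_cast
  rfl

theorem integral_cornerSimplex_powerSum_mul (n i j b : ℕ) :
    ∫ x in cornerSimplex n 1, powerSum i x * powerSum j x * (1 - ∑ i, x i) ^ b =
      powerSumMoment n i j b := by
  simp only [powerSum, Finset.sum_mul_sum]
  simp only [Finset.sum_mul]
  have hint : ∀ k l : Fin n, Integrable (fun x : Fin n → ℝ =>
      x k ^ i * x l ^ j * (1 - ∑ i, x i) ^ b) (volume.restrict (cornerSimplex n 1)) := fun k l =>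
    ContinuousOn.integrableOn_compact (isCompact_cornerSimplex _ _) (by fun_prop)
  rw [integral_finsetSum _ fun k _ => integrable_finsetSum _ fun l _ => hint k l]
  simp only [integral_finsetSum _ fun l _ => hint _ l, integral_cornerSimplex_pow_mul_pow]
  simp only [← Finset.sum_mul, ← Finset.sum_div]
  rw [powerSumMoment]
  congr 2
  have h : ∀ k l : Fin n, (if k = l then ((i + j).factorial : ℝ)
      else i.factorial * j.factorial) = i.factorial * j.factorial +
        if k = l then ((i + j).factorial - i.factorial * j.factorial : ℝ) else 0 := fun k l => by
    split_ifs <;> ring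
  simp only [h, Finset.sum_add_distrib, Finset.sum_ite_eq, Finset.sum_const, Finset.mem_univ,
    if_true, Finset.card_univ, Fintype.card_fin, nsmul_eq_mul]
  ring

theorem integral_cornerSimplex_sum_sq {ι : Type*} (s : Finset ι) (n : ℕ) (c : ι → ℝ)
    (i b : ι → ℕ) :
    ∫ x in cornerSimplex n 1, (∑ τ ∈ s, c τ * powerSum (i τ) x * (1 - ∑ i, x i) ^ b τ) ^ 2 =
      ∑ τ ∈ s, ∑ υ ∈ s, c τ * c υ * powerSumMoment n (i τ) (i υ) (b τ + b υ) := by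
  have hint : ∀ τ υ : ι, Integrable (fun x : Fin n → ℝ => c τ * c υ *
      (powerSum (i τ) x * powerSum (i υ) x * (1 - ∑ i, x i) ^ (b τ + b υ)))
      (volume.restrict (cornerSimplex n 1)) := fun τ υ =>
    ContinuousOn.integrableOn_compact (isCompact_cornerSimplex _ _)
      (by unfold powerSum; fun_prop)
  have h : ∀ x : Fin n → ℝ, (∑ τ ∈ s, c τ * powerSum (i τ) x * (1 - ∑ i, x i) ^ b τ) ^ 2 =
      ∑ τ ∈ s, ∑ υ ∈ s, c τ * c υ *
        (powerSum (i τ) x * powerSum (i υ) x * (1 - ∑ i, x i) ^ (b τ + b υ)) := fun x => by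
    rw [sq, Finset.sum_mul_sum]
    exact Finset.sum_congr rfl fun τ _ => Finset.sum_congr rfl fun υ _ => by ring
  simp only [h]
  rw [integral_finsetSum _ fun τ _ => integrable_finsetSum _ fun υ _ => hint τ υ]
  simp only [integral_finsetSum _ fun υ _ => hint _ υ, integral_const_mul,
    integral_cornerSimplex_powerSum_mul]

theorem cornerSimplex_one_subset_unitBox (n : ℕ) : cornerSimplex n 1 ⊆ unitBox n :=
  cornerSimplex_subset_pi_Icc n 1

theorem F5_eq_indicator : F5 = (cornerSimplex 5 1).indicator Ppoly := by
  ext x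
  simp [F5, Set.indicator_apply, cornerSimplex]

theorem setIntegral_unitBox_indicator {n : ℕ} (g : (Fin n → ℝ) → ℝ) :
    ∫ x in unitBox n, (cornerSimplex n 1).indicator g x = ∫ x in cornerSimplex n 1, g x := by
  rw [setIntegral_indicator (measurableSet_cornerSimplex _ _),
    Set.inter_eq_right.2 (cornerSimplex_one_subset_unitBox n)]

/-- `Ppoly` in terms of the slack `1 - Q₁` and the power sums `Q₂`, `Q₃`. -/
theorem Ppoly_eq (x : Fin 5 → ℝ) {u : ℝ} (hu : ∑ i, x i = 1 - u) :
    Ppoly x = 21 / 250 + 199 / 250 * u + 299 / 100 * u ^ 2 - 287 / 100 * u ^ 3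
      + (27 / 100 - 191 / 100 * u) * Qpow 2 x - 81 / 250 * Qpow 3 x := by
  have h : Qpow 1 x = 1 - u := by simpa [Qpow] using hu
  rw [Ppoly, h]
  ring

theorem integral_F5_sq : ∫ x in unitBox 5, F5 x ^ 2 = 1735763 / 1732500000 := by
  have h : ∀ x, F5 x ^ 2 = (cornerSimplex 5 1).indicator (fun x => (∑ τ : Fin 7,
      ![21 / 1250, 199 / 1250, 299 / 500, -287 / 500, 27 / 100, -191 / 100, -81 / 250] τ *
        powerSum (![0, 0, 0, 0, 2, 2, 3] τ) x *
          (1 - ∑ i, x i) ^ (![0, 1, 2, 3, 0, 1, 0] τ : ℕ)) ^ 2) x := fun x => by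
    rw [F5_eq_indicator, Set.indicator_apply, Set.indicator_apply]
    split_ifs
    · rw [Ppoly_eq x (u := 1 - ∑ i, x i) (by ring)]
      congr 1
      simp [Fin.sum_univ_seven, powerSum, Qpow]
      ring
    · simp
  simp only [h]
  rw [setIntegral_unitBox_indicator, integral_cornerSimplex_sum_sq]
  simp [Fin.sum_univ_seven, powerSumMoment, Nat.factorial]
  norm_num

theorem setIntegral_unitBox_succ {n : ℕ} (m : Fin (n + 1)) {g : (Fin (n + 1) → ℝ) → ℝ}
    {f : (Fin n → ℝ) → ℝ} (hgf : ∀ t y, g (m.insertNth t y) = f y) :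
    ∫ x in unitBox (n + 1), g x = ∫ y in unitBox n, f y := by
  have hmp := (volume_preserving_piFinSuccAbove (fun _ : Fin (n + 1) => ℝ) m).symm
  rw [← hmp.setIntegral_preimage_emb (MeasurableEquiv.measurableEmbedding _) g]
  have hpre : (MeasurableEquiv.piFinSuccAbove (fun _ : Fin (n + 1) => ℝ) m).symm ⁻¹'
      unitBox (n + 1) = Set.Icc 0 1 ×ˢ unitBox n := by
    ext ⟨t, y⟩
    simp only [Set.mem_preimage, unitBox, Set.mem_univ_pi, Set.mem_prod]
    change (∀ i, (m.insertNth t y : Fin (n + 1) → ℝ) i ∈ _) ↔ _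
    simp [Fin.forall_iff_succAbove m]
  have hg : ∀ z, g ((MeasurableEquiv.piFinSuccAbove (fun _ : Fin (n + 1) => ℝ) m).symm z) = f z.2 :=
    fun z => hgf z.1 z.2
  simp only [hpre, hg]
  rw [Measure.volume_eq_prod, ← Measure.prod_restrict, integral_fun_snd]
  simp

theorem integral_cubic (c₀ c₁ c₂ c₃ u : ℝ) :
    ∫ s in (0 : ℝ)..u, (c₀ + c₁ * s + c₂ * s ^ 2 + c₃ * s ^ 3) =
      c₀ * u + c₁ * u ^ 2 / 2 + c₂ * u ^ 3 / 3 + c₃ * u ^ 4 / 4 := by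
  have hderiv : ∀ s ∈ Set.uIcc 0 u, HasDerivAt
      (fun s : ℝ => c₀ * s + c₁ * s ^ 2 / 2 + c₂ * s ^ 3 / 3 + c₃ * s ^ 4 / 4)
      (c₀ + c₁ * s + c₂ * s ^ 2 + c₃ * s ^ 3) s := fun s _ => by
    refine (((((hasDerivAt_id s).const_mul c₀).add
      (((hasDerivAt_pow 2 s).const_mul c₁).div_const 2)).add
      (((hasDerivAt_pow 3 s).const_mul c₂).div_const 3)).add
      (((hasDerivAt_pow 4 s).const_mul c₃).div_const 4)).congr_deriv ?_
    push_cast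
    ring
  rw [intervalIntegral.integral_eq_sub_of_hasDerivAt hderiv
    (Continuous.intervalIntegrable (by fun_prop) _ _)]
  ring

theorem integral_F5_insertNth (m : Fin 5) {y : Fin 4 → ℝ} (hy : y ∈ unitBox 4) :
    ∫ s in (0 : ℝ)..1, F5 (m.insertNth s y) = (cornerSimplex 4 1).indicator (fun y =>
      ∑ τ : Fin 7,
        ![21 / 1000, 199 / 2000, 163 / 600, -2873 / 12000, 27 / 100, -191 / 200, -81 / 250] τ *
          powerSum (![0, 0, 0, 0, 2, 2, 3] τ) y *
            (1 - ∑ i, y i) ^ (![1, 2, 3, 4, 1, 2, 1] τ : ℕ)) y := by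
  have hy0 : ∀ i, 0 ≤ y i := fun i => (hy i trivial).1
  set u := 1 - ∑ i, y i with hu
  set q := powerSum 2 y with hq
  set p := powerSum 3 y with hp
  have hF : Set.EqOn (fun s => F5 (m.insertNth s y)) ((Set.Iic u).indicator fun s =>
      (21 / 250 + 199 / 250 * (u - s) + 299 / 100 * (u - s) ^ 2 - 287 / 100 * (u - s) ^ 3
      + (27 / 100 - 191 / 100 * (u - s)) * (s ^ 2 + q) - 81 / 250 * (s ^ 3 + p)))
      (Set.Ioc 0 1) := fun s hs => by
    simp only [F5_eq_indicator, Set.indicator_apply, insertNth_mem_cornerSimplex]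
    have hiff : (0 ≤ s ∧ y ∈ cornerSimplex 4 (1 - s)) ↔ s ∈ Set.Iic u := by
      simp only [cornerSimplex, Set.mem_ofPred_eq, Set.mem_Iic, hs.1.le, hy0, true_and,
        implies_true, hu]
      constructor <;> intro h <;> linarith
    simp only [hiff]
    split_ifs
    · rw [Ppoly_eq _ (u := u - s) (by rw [Fin.sum_univ_succAbove _ m]; simp [hu]; ring)]
      simp [Qpow, Fin.sum_univ_succAbove _ m, hq, hp, powerSum]
    · rfl
  rw [intervalIntegral.integral_of_le zero_le_one, setIntegral_congr_fun measurableSet_Ioc hF,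
    setIntegral_indicator measurableSet_Iic, Set.Ioc_inter_Iic, Set.indicator_apply]
  have hsum : 0 ≤ ∑ i, y i := Finset.sum_nonneg fun i _ => hy0 i
  rw [min_eq_right (by linarith)]
  split_ifs with hmem
  · have hu0 : 0 ≤ u := sub_nonneg.2 hmem.2
    rw [← intervalIntegral.integral_of_le hu0]
    simp only [Fin.sum_univ_seven]
    have hcubic := integral_cubic
      (21 / 250 + 199 / 250 * u + 299 / 100 * u ^ 2 - 287 / 100 * u ^ 3
        + (27 / 100 - 191 / 100 * u) * q - 81 / 250 * p)
      (-199 / 250 - 299 / 50 * u + 861 / 100 * u ^ 2 + 191 / 100 * q)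
      (299 / 100 - 861 / 100 * u + 27 / 100 - 191 / 100 * u)
      (287 / 100 + 191 / 100 - 81 / 250) u
    refine Eq.trans (intervalIntegral.integral_congr fun s _ => ?_) (hcubic.trans ?_)
    · ring
    simp [powerSum, hq, hp, ← hu]
    ring
  · rw [Set.Ioc_eq_empty, setIntegral_empty]
    exact fun h => hmem ⟨hy0, by linarith⟩

theorem integral_integral_F5_sq (m : Fin 5) :
    ∫ x in unitBox 5, (∫ s in (0 : ℝ)..1, F5 (Function.update x m s)) ^ 2 =
      722755717 / 1871100000000 := by
  rw [setIntegral_unitBox_succ m (f := fun y => (∫ s in (0 : ℝ)..1, F5 (m.insertNth s y)) ^ 2)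
    fun t y => by simp only [Fin.update_insertNth]]
  have hbox : MeasurableSet (unitBox 4) := MeasurableSet.univ_pi fun _ => measurableSet_Icc
  have h : ∀ y ∈ unitBox 4, (∫ s in (0 : ℝ)..1, F5 (m.insertNth s y)) ^ 2 =
      (cornerSimplex 4 1).indicator (fun y => (∑ τ : Fin 7,
        ![21 / 1000, 199 / 2000, 163 / 600, -2873 / 12000, 27 / 100, -191 / 200, -81 / 250] τ *
          powerSum (![0, 0, 0, 0, 2, 2, 3] τ) y *
            (1 - ∑ i, y i) ^ (![1, 2, 3, 4, 1, 2, 1] τ : ℕ)) ^ 2) y := fun y hy => by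
    rw [integral_F5_insertNth m hy, Set.indicator_apply, Set.indicator_apply, ite_pow,
      zero_pow two_ne_zero]
  rw [setIntegral_congr_fun hbox h, setIntegral_unitBox_indicator, integral_cornerSimplex_sum_sq]
  simp [Fin.sum_univ_seven, powerSumMoment, Nat.factorial]
  norm_num

/-- Numerical values of `I₅(F)` and `J₅^{(m)}(F)` for the test function of Theorem 1.4.
(The value `J₅^{(m)}(F)` is written as an integral over `[0,1]^5`; this agrees with the
`(k-1)`-fold integral since the integrand does not depend on the `m`-th coordinate.) -/
theorem I5_J5_values :
    (∫ x in unitBox 5, F5 x ^ 2) = 1735763 / 1732500000 ∧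
    ∀ m : Fin 5,
      (∫ x in unitBox 5, (∫ s in (0 : ℝ)..1, F5 (Function.update x m s)) ^ 2)
        = 722755717 / 1871100000000 :=
  ⟨integral_F5_sq, integral_integral_F5_sq⟩
end

section
/- Let F : ℝ³ → ℝ be defined by F(x,y,z) = (1−x)(1−y)(1−z) if x,y,z ≥ 0 and x+y+z ≤ 1, and F(x,y,z) = 0 otherwise. Take k = 3, θ = 1 and η = 10^{−10}. Then −Σ_{m=1}^3 L₃^{(m)}(F) + (1/4)·(1 + log((1−10^{−10})/10^{−10}))·Σ_{m=1}^3 J₃^{(m)}(F) + Σ_{m=1}^3 M₃^{(m)}(F) − 2·(1/2)·I₃(F) > 0, i.e. the quantity −Σ L₃^{(m)}(F) + (1/4)(1+log((1−η)/η))Σ J₃^{(m)}(F) + Σ M₃^{(m)}(F) − I₃(F) is strictly positive. -/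
open scoped Classical

/-- `I_k(F) = ∫_{[0,1]^k} F(t)² dt`. -/
noncomputable def Ik (k : ℕ) (F : (Fin k → ℝ) → ℝ) : ℝ :=
  ∫ x in unitBox k, (F x) ^ 2

/-- `J_k^{(m)}(F) = ∫_{[0,1]^{k-1}} (∫_0^1 F dt_m)² dt_{≠m}` (written as an integral over
`[0,1]^k`, which gives the same value since the integrand does not depend on `t_m`). -/
noncomputable def Jk (k : ℕ) (m : Fin k) (F : (Fin k → ℝ) → ℝ) : ℝ :=
  ∫ x in unitBox k, (∫ s in (0 : ℝ)..1, F (Function.update x m s)) ^ 2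

/-- The modified function `F_m(u; ξ)`, with `u_m` replaced by
`ξ/c + ((c - ξ)/c)·u_m`, where `c = θ/2`. -/
noncomputable def Fmod (k : ℕ) (c : ℝ) (m : Fin k) (F : (Fin k → ℝ) → ℝ) (ξ : ℝ)
    (x : Fin k → ℝ) : ℝ :=
  F (Function.update x m (ξ / c + ((c - ξ) / c) * x m))

/-- `L_k^{[m]}(ξ)`. -/
noncomputable def Lbrk (k : ℕ) (c : ℝ) (m : Fin k) (F : (Fin k → ℝ) → ℝ) (ξ : ℝ) : ℝ :=
  ∫ x in unitBox k,
    (∫ s in (0 : ℝ)..1, Fmod k c m F ξ (Function.update x m s)) *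
      (∫ s in (0 : ℝ)..1, F (Function.update x m s))

/-- `M_k^{[m]}(ξ)`. -/
noncomputable def Mbrk (k : ℕ) (c : ℝ) (m : Fin k) (F : (Fin k → ℝ) → ℝ) (ξ : ℝ) : ℝ :=
  ∫ x in unitBox k,
    (∫ s in (0 : ℝ)..1, Fmod k c m F ξ (Function.update x m s)) ^ 2

/-- `L_k^{(m)}(F) = ∫_η^c ((c-ξ)/(1-ξ)) L_k^{[m]}(ξ) dξ/ξ`, with `c = θ/2`. -/
noncomputable def Lk (k : ℕ) (c η : ℝ) (m : Fin k) (F : (Fin k → ℝ) → ℝ) : ℝ :=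
  ∫ ξ in η..c, (c - ξ) / (1 - ξ) * Lbrk k c m F ξ / ξ

/-- `M_k^{(m)}(F) = ∫_η^c ((c-ξ)²/(1-ξ)) M_k^{[m]}(ξ) dξ/ξ`, with `c = θ/2`. -/
noncomputable def Mk (k : ℕ) (c η : ℝ) (m : Fin k) (F : (Fin k → ℝ) → ℝ) : ℝ :=
  ∫ ξ in η..c, (c - ξ) ^ 2 / (1 - ξ) * Mbrk k c m F ξ / ξ

/-- The test function `F(x,y,z) = (1-x)(1-y)(1-z)` on the simplex, `0` elsewhere. -/
noncomputable def F3 (x : Fin 3 → ℝ) : ℝ :=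
  if (∀ i, 0 ≤ x i) ∧ (∑ i, x i) ≤ 1 then ∏ i, (1 - x i) else 0

open MeasureTheory intervalIntegral

/-- Integration over the unit cube, as an iterated integral with the `m`-th coordinate innermost. -/
lemma setIntegral_unitBox_three (m : Fin 3) (h : ℝ → ℝ → ℝ → ℝ)
    (hh : IntegrableOn (fun p : ℝ × ℝ × ℝ => h p.1 p.2.1 p.2.2)
      (Set.Icc 0 1 ×ˢ Set.Icc 0 1 ×ˢ Set.Icc 0 1)) :
    ∫ x in unitBox 3, h (x (m.succAbove 0)) (x (m.succAbove 1)) (x m) =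
      ∫ y in (0 : ℝ)..1, ∫ z in (0 : ℝ)..1, ∫ t in (0 : ℝ)..1, h y z t := by
  let e : (Fin 3 → ℝ) ≃ᵐ ℝ × ℝ × ℝ :=
    ((MeasurableEquiv.piFinSuccAbove (fun _ : Fin 3 => ℝ) m).trans
      ((MeasurableEquiv.refl ℝ).prodCongr MeasurableEquiv.finTwoArrow)).trans
      (MeasurableEquiv.prodComm.trans MeasurableEquiv.prodAssoc)
  have he : MeasurePreserving e volume volume := by
    have h₁ := volume_preserving_piFinSuccAbove (fun _ : Fin 3 => ℝ) m
    have h₂ : MeasurePreserving (Prod.map (id : ℝ → ℝ) (MeasurableEquiv.finTwoArrow (α := ℝ)))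
        volume volume :=
      (MeasurePreserving.id volume).prod (volume_preserving_finTwoArrow ℝ)
    have h₃ : MeasurePreserving (Prod.swap : ℝ × ℝ × ℝ → (ℝ × ℝ) × ℝ) volume volume :=
      Measure.measurePreserving_swap
    have h₄ : MeasurePreserving (MeasurableEquiv.prodAssoc : (ℝ × ℝ) × ℝ ≃ᵐ ℝ × ℝ × ℝ)
        volume volume := volume_preserving_prodAssoc
    exact (h₄.comp h₃).comp (h₂.comp h₁)
  have hpre : e ⁻¹' (Set.Icc 0 1 ×ˢ Set.Icc 0 1 ×ˢ Set.Icc 0 1) = unitBox 3 := by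
    ext x
    have hx : e x = (x (m.succAbove 0), x (m.succAbove 1), x m) := rfl
    simp only [Set.mem_preimage, hx, unitBox, Set.mem_prod, Set.mem_pi, Set.mem_univ,
      true_implies, Fin.forall_iff_succAbove m, Fin.forall_fin_two]
    tauto
  rw [← hpre]
  refine (he.setIntegral_preimage_emb e.measurableEmbedding
    (fun p : ℝ × ℝ × ℝ => h p.1 p.2.1 p.2.2) _).trans ?_
  have key := hh
  rw [IntegrableOn, Measure.volume_eq_prod, ← Measure.prod_restrict] at key
  rw [Measure.volume_eq_prod, setIntegral_prod _ hh,
    integral_of_le zero_le_one, ← integral_Icc_eq_integral_Ioc]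
  refine integral_congr_ae ?_
  filter_upwards [key.prod_right_ae] with y hy
  rw [integral_of_le zero_le_one, ← integral_Icc_eq_integral_Ioc, Measure.volume_eq_prod,
    setIntegral_prod _ hy]
  simp only [integral_of_le zero_le_one, ← integral_Icc_eq_integral_Ioc]

lemma setIntegral_unitBox_three_of_continuous (m : Fin 3) (g : ℝ → ℝ → ℝ)
    (hg : Continuous fun p : ℝ × ℝ => g p.1 p.2) :
    ∫ x in unitBox 3, g (x (m.succAbove 0)) (x (m.succAbove 1)) =
      ∫ y in (0 : ℝ)..1, ∫ z in (0 : ℝ)..1, g y z := by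
  have := setIntegral_unitBox_three m (fun y z _ => g y z) (by
    refine ContinuousOn.integrableOn_compact
      (isCompact_Icc.prod (isCompact_Icc.prod isCompact_Icc)) ?_
    exact (hg.comp (by fun_prop : Continuous fun p : ℝ × ℝ × ℝ => (p.1, p.2.1))).continuousOn)
  simpa using this

lemma integral_ite_le {a b c : ℝ} (hab : a ≤ b) (hcb : c ≤ b) (g : ℝ → ℝ) :
    ∫ t in a..b, (if t ≤ c then g t else 0) = if a ≤ c then ∫ t in a..c, g t else 0 := by
  split_ifs with hac
  · exact integral_indicator (f := g) (μ := volume) ⟨hac, hcb⟩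
  · rw [integral_congr (g := fun _ => (0 : ℝ)), intervalIntegral.integral_zero]
    intro t ht
    rw [Set.uIcc_of_le hab] at ht
    exact if_neg (by linarith [ht.1])

/-- The value of `∫ t in 1 - r..1, F(t, y, z)` is `(1 - y) (1 - z) sliceWeight r (y + z)`. -/
noncomputable def sliceWeight (r σ : ℝ) : ℝ := max (r ^ 2 - σ ^ 2) 0 / 2

@[fun_prop]
lemma continuous_sliceWeight (r : ℝ) : Continuous (sliceWeight r) := by
  unfold sliceWeight; fun_prop

lemma F3_update (m : Fin 3) (x : Fin 3 → ℝ) (t : ℝ) :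
    F3 (Function.update x m t) =
      if (0 ≤ t ∧ 0 ≤ x (m.succAbove 0) ∧ 0 ≤ x (m.succAbove 1)) ∧
        t + (x (m.succAbove 0) + x (m.succAbove 1)) ≤ 1
      then (1 - t) * ((1 - x (m.succAbove 0)) * (1 - x (m.succAbove 1))) else 0 := by
  simp [F3, Fin.forall_iff_succAbove m, Fin.sum_univ_succAbove _ m, Fin.prod_univ_succAbove _ m,
    Fin.forall_fin_two, Fin.sum_univ_two, Fin.prod_univ_two]

lemma integral_F3_update {m : Fin 3} {x : Fin 3 → ℝ} (hx : x ∈ unitBox 3) {r : ℝ} (hr : 0 ≤ r)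
    (hr' : r ≤ 1) :
    ∫ t in (1 - r)..1, F3 (Function.update x m t) =
      (1 - x (m.succAbove 0)) * (1 - x (m.succAbove 1)) *
        sliceWeight r (x (m.succAbove 0) + x (m.succAbove 1)) := by
  have hy := (hx (m.succAbove 0) trivial).1
  have hz := (hx (m.succAbove 1) trivial).1
  set y := x (m.succAbove 0) with hy_def
  set z := x (m.succAbove 1) with hz_def
  have h₁ : ∫ t in (1 - r)..1, F3 (Function.update x m t) =
      ∫ t in (1 - r)..1, if t ≤ 1 - (y + z) then (1 - t) * ((1 - y) * (1 - z)) else 0 := by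
    refine integral_congr fun t ht => ?_
    rw [Set.uIcc_of_le (by linarith)] at ht
    simp only [F3_update, ← hy_def, ← hz_def]
    refine if_congr ⟨fun h => by linarith [h.2], fun h => ⟨⟨by linarith [ht.1], hy, hz⟩, ?_⟩⟩ rfl rfl
    linarith
  rw [h₁, integral_ite_le (by linarith) (by linarith)]
  split_ifs with h
  · have : ∀ t ∈ Set.uIcc (1 - r) (1 - (y + z)),
        HasDerivAt (fun t : ℝ => -((1 - t) ^ 2 / 2 * ((1 - y) * (1 - z))))
          ((1 - t) * ((1 - y) * (1 - z))) t := fun t _ => by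
      have := (((((hasDerivAt_id t).const_sub 1).pow 2).div_const 2).mul_const
        ((1 - y) * (1 - z))).neg
      refine this.congr_deriv ?_
      simp
      ring
    rw [integral_eq_sub_of_hasDerivAt this
      ((by fun_prop : Continuous _).intervalIntegrable _ _), sliceWeight, max_eq_left]
    · ring
    · nlinarith
  · rw [sliceWeight, max_eq_right]
    · simp
    · nlinarith

lemma integral_Fmod_F3 {m : Fin 3} {x : Fin 3 → ℝ} (hx : x ∈ unitBox 3) {ξ : ℝ} (h₀ : 0 ≤ ξ)
    (h₁ : ξ ≤ 1 / 2) :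
    (1 - 2 * ξ) * ∫ s in (0 : ℝ)..1, Fmod 3 (1 / 2) m F3 ξ (Function.update x m s) =
      (1 - x (m.succAbove 0)) * (1 - x (m.succAbove 1)) *
        sliceWeight (1 - 2 * ξ) (x (m.succAbove 0) + x (m.succAbove 1)) := by
  rw [← integral_F3_update hx (r := 1 - 2 * ξ) (by linarith) (by linarith)]
  have := mul_integral_comp_add_mul (a := 0) (b := 1)
    (f := fun t => F3 (Function.update x m t)) (1 - 2 * ξ) (2 * ξ)
  rw [show 2 * ξ + (1 - 2 * ξ) * 0 = 1 - (1 - 2 * ξ) by ring,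
    show 2 * ξ + (1 - 2 * ξ) * 1 = 1 by ring] at this
  rw [← this]
  congr 1
  refine integral_congr fun s _ => ?_
  simp only [Fmod, Function.update_self, Function.update_idem]
  congr 2
  ring

/-- `∫∫ (1 - y)² (1 - z)² (y + z)ᵏ` over the triangle `y, z ≥ 0`, `y + z ≤ r`. -/
noncomputable def triangleMoment (k : ℕ) (r : ℝ) : ℝ :=
  r ^ (k + 2) / (k + 2) - 2 * (r ^ (k + 3) / (k + 3)) + 4 / 3 * (r ^ (k + 4) / (k + 4))
    - 1 / 3 * (r ^ (k + 5) / (k + 5)) + 1 / 30 * (r ^ (k + 6) / (k + 6))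

lemma hasDerivAt_pow_succ_div (k : ℕ) (x : ℝ) :
    HasDerivAt (fun x : ℝ => x ^ (k + 1) / ((k : ℝ) + 1)) (x ^ k) x := by
  refine ((hasDerivAt_pow (k + 1) x).div_const _).congr_deriv ?_
  have : (k : ℝ) + 1 ≠ 0 := by positivity
  push_cast
  field_simp

lemma integral_one_sub_sq_mul_sum_pow (n : ℕ) (a : ℕ → ℝ) (r y : ℝ) :
    ∫ z in (0 : ℝ)..(r - y), (1 - z) ^ 2 * ∑ k ∈ Finset.range n, a k * (y + z) ^ k =
      ∑ k ∈ Finset.range n, a k *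
        ((1 + y) ^ 2 * ((r ^ (k + 1) - y ^ (k + 1)) / (k + 1))
          - 2 * (1 + y) * ((r ^ (k + 2) - y ^ (k + 2)) / (k + 2))
          + (r ^ (k + 3) - y ^ (k + 3)) / (k + 3)) := by
  have hpow (k : ℕ) (z : ℝ) : HasDerivAt (fun z : ℝ => (y + z) ^ (k + 1) / ((k : ℝ) + 1))
      ((y + z) ^ k) z := by
    simpa using (hasDerivAt_pow_succ_div k (y + z)).comp_const_add y z
  have hd : ∀ z ∈ Set.uIcc 0 (r - y), HasDerivAt
      (fun z => ∑ k ∈ Finset.range n, a k *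
        ((1 + y) ^ 2 * ((y + z) ^ (k + 1) / (k + 1))
          - 2 * (1 + y) * ((y + z) ^ (k + 1 + 1) / ((k + 1 : ℕ) + 1))
          + (y + z) ^ (k + 2 + 1) / ((k + 2 : ℕ) + 1)))
      ((1 - z) ^ 2 * ∑ k ∈ Finset.range n, a k * (y + z) ^ k) z := fun z _ => by
    have := HasDerivAt.fun_sum (u := Finset.range n) (x := z) fun k _ =>
      ((((hpow k z).const_mul ((1 + y) ^ 2)).sub
        ((hpow (k + 1) z).const_mul (2 * (1 + y)))).add (hpow (k + 2) z)).const_mul (a k)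
    refine this.congr_deriv ?_
    rw [Finset.mul_sum]
    refine Finset.sum_congr rfl fun k _ => ?_
    ring
  rw [integral_eq_sub_of_hasDerivAt hd (by
    refine Continuous.intervalIntegrable ?_ _ _
    fun_prop), ← Finset.sum_sub_distrib]
  refine Finset.sum_congr rfl fun k _ => ?_
  rw [add_sub_cancel, add_zero]
  push_cast
  ring

lemma integral_triangle (n : ℕ) (a : ℕ → ℝ) {r : ℝ} (h₀ : 0 ≤ r) (h₁ : r ≤ 1) :
    ∫ y in (0 : ℝ)..1, ∫ z in (0 : ℝ)..1, (1 - y) ^ 2 * ((1 - z) ^ 2 *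
      if y + z ≤ r then ∑ k ∈ Finset.range n, a k * (y + z) ^ k else 0) =
      ∑ k ∈ Finset.range n, a k * triangleMoment k r := by
  have hinner : ∀ y ∈ Set.uIcc (0 : ℝ) 1,
      (∫ z in (0 : ℝ)..1, (1 - y) ^ 2 * ((1 - z) ^ 2 *
        if y + z ≤ r then ∑ k ∈ Finset.range n, a k * (y + z) ^ k else 0)) =
      if y ≤ r then (1 - y) ^ 2 * ∑ k ∈ Finset.range n, a k *
        ((1 + y) ^ 2 * ((r ^ (k + 1) - y ^ (k + 1)) / (k + 1))
          - 2 * (1 + y) * ((r ^ (k + 2) - y ^ (k + 2)) / (k + 2))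
          + (r ^ (k + 3) - y ^ (k + 3)) / (k + 3)) else 0 := fun y hy => by
    rw [Set.uIcc_of_le zero_le_one] at hy
    rw [intervalIntegral.integral_const_mul]
    simp only [mul_ite, mul_zero, ← le_sub_iff_add_le']
    rw [integral_ite_le zero_le_one (by linarith [hy.1]), integral_one_sub_sq_mul_sum_pow]
    simp only [sub_nonneg, mul_ite, mul_zero]
  rw [integral_congr hinner, integral_ite_le zero_le_one h₁, if_pos h₀]
  have hd : ∀ y ∈ Set.uIcc 0 r, HasDerivAt
      (fun y => ∑ k ∈ Finset.range n, a k *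
        (r ^ (k + 1) / (k + 1) * (y ^ (0 + 1) / ((0 : ℕ) + 1) - 2 * (y ^ (2 + 1) / ((2 : ℕ) + 1))
            + y ^ (4 + 1) / ((4 : ℕ) + 1))
          - 2 * (r ^ (k + 2) / (k + 2)) * (y ^ (0 + 1) / ((0 : ℕ) + 1)
            - y ^ (1 + 1) / ((1 : ℕ) + 1) - y ^ (2 + 1) / ((2 : ℕ) + 1)
            + y ^ (3 + 1) / ((3 : ℕ) + 1))
          + r ^ (k + 3) / (k + 3) * (y ^ (0 + 1) / ((0 : ℕ) + 1)
            - 2 * (y ^ (1 + 1) / ((1 : ℕ) + 1)) + y ^ (2 + 1) / ((2 : ℕ) + 1))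
          - 1 / (k + 1) * (y ^ (k + 1 + 1) / ((k + 1 : ℕ) + 1)
            - 2 * (y ^ (k + 3 + 1) / ((k + 3 : ℕ) + 1)) + y ^ (k + 5 + 1) / ((k + 5 : ℕ) + 1))
          + 2 * (1 / (k + 2)) * (y ^ (k + 2 + 1) / ((k + 2 : ℕ) + 1)
            - y ^ (k + 3 + 1) / ((k + 3 : ℕ) + 1) - y ^ (k + 4 + 1) / ((k + 4 : ℕ) + 1)
            + y ^ (k + 5 + 1) / ((k + 5 : ℕ) + 1))
          - 1 / (k + 3) * (y ^ (k + 3 + 1) / ((k + 3 : ℕ) + 1)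
            - 2 * (y ^ (k + 4 + 1) / ((k + 4 : ℕ) + 1)) + y ^ (k + 5 + 1) / ((k + 5 : ℕ) + 1))))
      ((1 - y) ^ 2 * ∑ k ∈ Finset.range n, a k *
        ((1 + y) ^ 2 * ((r ^ (k + 1) - y ^ (k + 1)) / (k + 1))
          - 2 * (1 + y) * ((r ^ (k + 2) - y ^ (k + 2)) / (k + 2))
          + (r ^ (k + 3) - y ^ (k + 3)) / (k + 3))) y := fun y _ => by
    have hp (j : ℕ) := hasDerivAt_pow_succ_div j y
    have := HasDerivAt.fun_sum (u := Finset.range n) (x := y) fun k _ =>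
      (((((((((hp 0).sub ((hp 2).const_mul 2)).add (hp 4)).const_mul (r ^ (k + 1) / ((k : ℝ) + 1))).sub
        (((((hp 0).sub (hp 1)).sub (hp 2)).add (hp 3)).const_mul
          (2 * (r ^ (k + 2) / ((k : ℝ) + 2))))).add
        ((((hp 0).sub ((hp 1).const_mul 2)).add (hp 2)).const_mul
          (r ^ (k + 3) / ((k : ℝ) + 3)))).sub
        ((((hp (k + 1)).sub ((hp (k + 3)).const_mul 2)).add (hp (k + 5))).const_mul
          (1 / ((k : ℝ) + 1)))).add
        (((((hp (k + 2)).sub (hp (k + 3))).sub (hp (k + 4))).add (hp (k + 5))).const_mul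
          (2 * (1 / ((k : ℝ) + 2))))).sub
        ((((hp (k + 3)).sub ((hp (k + 4)).const_mul 2)).add (hp (k + 5))).const_mul
          (1 / ((k : ℝ) + 3)))).const_mul (a k)
    refine this.congr_deriv ?_
    rw [Finset.mul_sum]
    refine Finset.sum_congr rfl fun k _ => ?_
    ring
  rw [integral_eq_sub_of_hasDerivAt hd (by
    refine Continuous.intervalIntegrable ?_ _ _
    fun_prop), ← Finset.sum_sub_distrib]
  refine Finset.sum_congr rfl fun k _ => ?_
  rw [← mul_sub]
  congr 1
  have h1 : (k : ℝ) + 1 ≠ 0 := by positivity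
  have h2 : (k : ℝ) + 2 ≠ 0 := by positivity
  have h3 : (k : ℝ) + 3 ≠ 0 := by positivity
  have h4 : (k : ℝ) + 4 ≠ 0 := by positivity
  have h5 : (k : ℝ) + 5 ≠ 0 := by positivity
  have h6 : (k : ℝ) + 6 ≠ 0 := by positivity
  simp only [triangleMoment, Nat.cast_add, Nat.cast_one, Nat.cast_ofNat, add_assoc]
  norm_num
  field_simp
  ring

/-- `∫∫ (1 - y)² (1 - z)² (r² - (y + z)²) (s² - (y + z)²) / 4` over the triangle `y, z ≥ 0`,
`y + z ≤ r`. -/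
noncomputable def sliceEnergy (r s : ℝ) : ℝ :=
  (r ^ 2 * s ^ 2 * triangleMoment 0 r - (r ^ 2 + s ^ 2) * triangleMoment 2 r
    + triangleMoment 4 r) / 4

lemma setIntegral_sliceWeight_mul (m : Fin 3) {r s : ℝ} (h₀ : 0 ≤ r) (hrs : r ≤ s) (h₁ : r ≤ 1) :
    ∫ x in unitBox 3, ((1 - x (m.succAbove 0)) * (1 - x (m.succAbove 1)) *
        sliceWeight r (x (m.succAbove 0) + x (m.succAbove 1))) *
      ((1 - x (m.succAbove 0)) * (1 - x (m.succAbove 1)) *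
        sliceWeight s (x (m.succAbove 0) + x (m.succAbove 1))) = sliceEnergy r s := by
  rw [setIntegral_unitBox_three_of_continuous m (fun y z =>
    ((1 - y) * (1 - z) * sliceWeight r (y + z)) * ((1 - y) * (1 - z) * sliceWeight s (y + z)))
    (by fun_prop)]
  let a : ℕ → ℝ := fun k => if k = 0 then r ^ 2 * s ^ 2 / 4 else
    if k = 2 then -(r ^ 2 + s ^ 2) / 4 else if k = 4 then 1 / 4 else 0
  have := integral_triangle 5 a h₀ h₁
  rw [show sliceEnergy r s = ∑ k ∈ Finset.range 5, a k * triangleMoment k r by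
    simp [Finset.sum_range_succ, a, sliceEnergy]; ring, ← this]
  refine integral_congr fun y hy => integral_congr fun z hz => ?_
  rw [Set.uIcc_of_le zero_le_one] at hy hz
  have hσ : 0 ≤ y + z := add_nonneg hy.1 hz.1
  simp only [sliceWeight]
  split_ifs with h
  · rw [max_eq_left (by nlinarith), max_eq_left (by nlinarith)]
    simp [Finset.sum_range_succ, a]
    ring
  · rw [max_eq_right (a := r ^ 2 - (y + z) ^ 2) (by nlinarith)]
    ring

lemma measurableSet_unitBox (k : ℕ) : MeasurableSet (unitBox k) :=
  MeasurableSet.univ_pi fun _ => measurableSet_Icc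

lemma integral_zero_one_F3_update {m : Fin 3} {x : Fin 3 → ℝ} (hx : x ∈ unitBox 3) :
    ∫ t in (0 : ℝ)..1, F3 (Function.update x m t) =
      (1 - x (m.succAbove 0)) * (1 - x (m.succAbove 1)) *
        sliceWeight 1 (x (m.succAbove 0) + x (m.succAbove 1)) := by
  simpa using integral_F3_update (m := m) hx zero_le_one le_rfl

lemma Jk_F3 (m : Fin 3) : Jk 3 m F3 = sliceEnergy 1 1 := by
  rw [Jk, ← setIntegral_sliceWeight_mul m zero_le_one le_rfl le_rfl]
  refine setIntegral_congr_fun (measurableSet_unitBox 3) fun x hx => ?_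
  simp only [integral_zero_one_F3_update hx, sq]

lemma Lbrk_F3 (m : Fin 3) {ξ : ℝ} (h₀ : 0 ≤ ξ) (h₁ : ξ ≤ 1 / 2) :
    (1 - 2 * ξ) * Lbrk 3 (1 / 2) m F3 ξ = sliceEnergy (1 - 2 * ξ) 1 := by
  rw [Lbrk, ← setIntegral_sliceWeight_mul m (by linarith) (by linarith) (by linarith),
    ← MeasureTheory.integral_const_mul]
  refine setIntegral_congr_fun (measurableSet_unitBox 3) fun x hx => ?_
  simp only [integral_zero_one_F3_update hx, ← integral_Fmod_F3 hx h₀ h₁]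
  ring

lemma Mbrk_F3 (m : Fin 3) {ξ : ℝ} (h₀ : 0 ≤ ξ) (h₁ : ξ ≤ 1 / 2) :
    (1 - 2 * ξ) ^ 2 * Mbrk 3 (1 / 2) m F3 ξ = sliceEnergy (1 - 2 * ξ) (1 - 2 * ξ) := by
  rw [Mbrk, ← setIntegral_sliceWeight_mul m (by linarith) le_rfl (by linarith),
    ← MeasureTheory.integral_const_mul]
  refine setIntegral_congr_fun (measurableSet_unitBox 3) fun x hx => ?_
  simp only [← integral_Fmod_F3 hx h₀ h₁]
  ring

lemma Lk_F3 (m : Fin 3) {η : ℝ} (h₀ : 0 ≤ η) (h₁ : η ≤ 1 / 2) :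
    Lk 3 (1 / 2) η m F3 =
      ∫ ξ in η..(1 / 2), 1 / 2 * sliceEnergy (1 - 2 * ξ) 1 * (1 / (ξ * (1 - ξ))) := by
  refine integral_congr fun ξ hξ => ?_
  rw [Set.uIcc_of_le h₁] at hξ
  simp only [← Lbrk_F3 m (h₀.trans hξ.1) hξ.2, mul_inv, div_eq_mul_inv]
  ring

lemma Mk_F3 (m : Fin 3) {η : ℝ} (h₀ : 0 ≤ η) (h₁ : η ≤ 1 / 2) :
    Mk 3 (1 / 2) η m F3 = ∫ ξ in η..(1 / 2),
      1 / 4 * sliceEnergy (1 - 2 * ξ) (1 - 2 * ξ) * (1 / (ξ * (1 - ξ))) := by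
  refine integral_congr fun ξ hξ => ?_
  rw [Set.uIcc_of_le h₁] at hξ
  simp only [← Mbrk_F3 m (h₀.trans hξ.1) hξ.2, mul_inv, div_eq_mul_inv]
  ring

lemma F3_eq (x : Fin 3 → ℝ) :
    F3 x = if (0 ≤ x 0 ∧ 0 ≤ x 1 ∧ 0 ≤ x 2) ∧ x 0 + (x 1 + x 2) ≤ 1
      then (1 - x 0) * ((1 - x 1) * (1 - x 2)) else 0 := by
  have := F3_update 0 x (x 0)
  rw [Function.update_eq_self] at this
  convert this using 2 <;> rfl

lemma Ik_F3 : Ik 3 F3 = (triangleMoment 0 1 - triangleMoment 3 1) / 3 := by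
  let h : ℝ → ℝ → ℝ → ℝ := fun y z t => if (0 ≤ t ∧ 0 ≤ y ∧ 0 ≤ z) ∧ t + (y + z) ≤ 1
    then ((1 - t) * ((1 - y) * (1 - z))) ^ 2 else 0
  have hint : IntegrableOn (fun p : ℝ × ℝ × ℝ => h p.1 p.2.1 p.2.2)
      (Set.Icc 0 1 ×ˢ Set.Icc 0 1 ×ˢ Set.Icc 0 1) := by
    have hs : MeasurableSet {p : ℝ × ℝ × ℝ |
        (0 ≤ p.2.2 ∧ 0 ≤ p.1 ∧ 0 ≤ p.2.1) ∧ p.2.2 + (p.1 + p.2.1) ≤ 1} := by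
      measurability
    refine IntegrableOn.congr_fun (f := Set.indicator {p : ℝ × ℝ × ℝ |
        (0 ≤ p.2.2 ∧ 0 ≤ p.1 ∧ 0 ≤ p.2.1) ∧ p.2.2 + (p.1 + p.2.1) ≤ 1} fun p : ℝ × ℝ × ℝ =>
      ((1 - p.2.2) * ((1 - p.1) * (1 - p.2.1))) ^ 2) ?_ (fun p _ => by simp [Set.indicator, h])
      (measurableSet_Icc.prod (measurableSet_Icc.prod measurableSet_Icc))
    refine IntegrableOn.indicator (ContinuousOn.integrableOn_compact
      (isCompact_Icc.prod (isCompact_Icc.prod isCompact_Icc)) ?_) hs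
    fun_prop
  have hbox : Ik 3 F3 = ∫ x in unitBox 3,
      h (x ((0 : Fin 3).succAbove 0)) (x ((0 : Fin 3).succAbove 1)) (x 0) := by
    refine setIntegral_congr_fun (measurableSet_unitBox 3) fun x _ => ?_
    simp [h, F3_eq, ite_pow]
  let a : ℕ → ℝ := fun k => if k = 0 then 1 / 3 else if k = 3 then -1 / 3 else 0
  rw [hbox, setIntegral_unitBox_three 0 h hint,
    show (triangleMoment 0 1 - triangleMoment 3 1) / 3 =
      ∑ k ∈ Finset.range 4, a k * triangleMoment k 1 by
    simp [Finset.sum_range_succ, a]; ring, ← integral_triangle 4 a zero_le_one le_rfl]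
  refine integral_congr fun y hy => integral_congr fun z hz => ?_
  rw [Set.uIcc_of_le zero_le_one] at hy hz
  have h₁ : ∫ t in (0 : ℝ)..1, h y z t = ∫ t in (0 : ℝ)..1,
      if t ≤ 1 - (y + z) then ((1 - t) * ((1 - y) * (1 - z))) ^ 2 else 0 := by
    refine integral_congr fun t ht => ?_
    rw [Set.uIcc_of_le zero_le_one] at ht
    exact if_congr ⟨fun h => by linarith [h.2], fun h => ⟨⟨ht.1, hy.1, hz.1⟩, by linarith⟩⟩ rfl rfl
  simp only [h₁]
  rw [integral_ite_le zero_le_one (by linarith [hy.1, hz.1])]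
  simp only [sub_nonneg]
  split_ifs with hσ
  · have : ∀ t ∈ Set.uIcc 0 (1 - (y + z)),
        HasDerivAt (fun t : ℝ => -((1 - t) ^ 3 / 3 * ((1 - y) * (1 - z)) ^ 2))
          (((1 - t) * ((1 - y) * (1 - z))) ^ 2) t := fun t _ => by
      have := (((((hasDerivAt_id t).const_sub 1).pow 3).div_const 3).mul_const
        (((1 - y) * (1 - z)) ^ 2)).neg
      refine this.congr_deriv ?_
      simp
      ring
    rw [integral_eq_sub_of_hasDerivAt this (by
      refine Continuous.intervalIntegrable ?_ _ _
      fun_prop)]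
    simp [Finset.sum_range_succ, a]
    ring
  · simp

lemma integral_one_div_mul_one_sub {η : ℝ} (h₀ : 0 < η) (h₁ : η ≤ 1 / 2) :
    ∫ ξ in η..(1 / 2), 1 / (ξ * (1 - ξ)) = Real.log ((1 - η) / η) := by
  have hd : ∀ ξ ∈ Set.uIcc η (1 / 2),
      HasDerivAt (fun ξ => Real.log ξ - Real.log (1 - ξ)) (1 / (ξ * (1 - ξ))) ξ := fun ξ hξ => by
    rw [Set.uIcc_of_le h₁] at hξ
    have hξ₀ : ξ ≠ 0 := (h₀.trans_le hξ.1).ne'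
    have hξ₁ : 1 - ξ ≠ 0 := by linarith [hξ.2]
    refine ((Real.hasDerivAt_log hξ₀).sub
      (((hasDerivAt_id ξ).const_sub 1).log hξ₁)).congr_deriv ?_
    simp only [id]
    field_simp
    ring
  rw [integral_eq_sub_of_hasDerivAt hd, Real.log_div (by linarith) h₀.ne']
  · norm_num
  · refine ContinuousOn.intervalIntegrable fun ξ hξ => ?_
    rw [Set.uIcc_of_le h₁] at hξ
    have : ξ * (1 - ξ) ≠ 0 := (mul_pos (h₀.trans_le hξ.1) (by linarith [hξ.2])).ne'
    exact ContinuousAt.continuousWithinAt (by fun_prop (disch := assumption))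

/-- The square integral of `∫ t in 0..2ξ, F(t, y, z)`, divided by `ξ²`. -/
noncomputable def defectPoly (x : ℝ) : ℝ :=
  19 / 45 - 46 / 45 * x + 7 / 45 * x ^ 2 - 8 / 225 * x ^ 3 + 40 / 9 * x ^ 4 - 1696 / 315 * x ^ 5
    - 8 / 45 * x ^ 6 + 128 / 135 * x ^ 7 + 128 / 225 * x ^ 8

lemma sliceEnergy_defect (ξ : ℝ) :
    sliceEnergy 1 1 - 2 * sliceEnergy (1 - 2 * ξ) 1 + sliceEnergy (1 - 2 * ξ) (1 - 2 * ξ) =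
      ξ ^ 2 * defectPoly ξ := by
  simp only [sliceEnergy, triangleMoment, defectPoly]
  push_cast
  ring

/-- Nonnegativity of the coefficients of `defectPoly` in the Bernstein basis of `[0, 1/2]`. -/
lemma defectPoly_nonneg {x : ℝ} (h₀ : 0 ≤ x) (h₁ : x ≤ 1 / 2) : 0 ≤ defectPoly x := by
  have hy : 0 ≤ 1 - 2 * x := by linarith
  have : defectPoly x = 19 / 45 * (1 - 2 * x) ^ 8 + 86 / 15 * (x * (1 - 2 * x) ^ 7)
      + 497 / 15 * (x ^ 2 * (1 - 2 * x) ^ 6) + 2628 / 25 * (x ^ 3 * (1 - 2 * x) ^ 5)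
      + 9004 / 45 * (x ^ 4 * (1 - 2 * x) ^ 4) + 74912 / 315 * (x ^ 5 * (1 - 2 * x) ^ 3)
      + 18728 / 105 * (x ^ 6 * (1 - 2 * x) ^ 2) + 74912 / 945 * (x ^ 7 * (1 - 2 * x))
      + 74912 / 4725 * x ^ 8 := by
    unfold defectPoly
    ring
  rw [this]
  positivity

/-- A primitive of `x * (1 + x + x ^ 2) * defectPoly x`. -/
noncomputable def defectPrimitive (x : ℝ) : ℝ :=
  19 / 90 * x ^ 2 - 1 / 5 * x ^ 3 - 1 / 9 * x ^ 4 - 203 / 1125 * x ^ 5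
    + 1027 / 1350 * x ^ 6 - 512 / 3675 * x ^ 7 - 44 / 315 * x ^ 8 - 872 / 1701 * x ^ 9
    + 452 / 3375 * x ^ 10 + 1024 / 7425 * x ^ 11 + 32 / 675 * x ^ 12

lemma integral_defect_minorant (η : ℝ) :
    ∫ x in η..(1 / 2), x * (1 + x + x ^ 2) * defectPoly x =
      defectPrimitive (1 / 2) - defectPrimitive η := by
  refine integral_eq_sub_of_hasDerivAt (fun x _ => ?_) ?_
  · have hp (n : ℕ) (c : ℝ) := (hasDerivAt_pow n x).const_mul c
    refine (((((((((((hp 2 (19 / 90)).sub (hp 3 (1 / 5))).sub (hp 4 (1 / 9))).sub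
      (hp 5 (203 / 1125))).add (hp 6 (1027 / 1350))).sub (hp 7 (512 / 3675))).sub
      (hp 8 (44 / 315))).sub (hp 9 (872 / 1701))).add (hp 10 (452 / 3375))).add
      (hp 11 (1024 / 7425))).add (hp 12 (32 / 675))).congr_deriv ?_
    unfold defectPoly
    push_cast
    ring
  · refine Continuous.intervalIntegrable ?_ _ _
    unfold defectPoly
    fun_prop

lemma intervalIntegrable_mul_one_div_mul_one_sub {f : ℝ → ℝ} (hf : Continuous f) {η : ℝ}
    (h₀ : 0 < η) (h₁ : η ≤ 1 / 2) :
    IntervalIntegrable (fun ξ => f ξ * (1 / (ξ * (1 - ξ)))) volume η (1 / 2) := by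
  refine ContinuousOn.intervalIntegrable fun ξ hξ => ?_
  rw [Set.uIcc_of_le h₁] at hξ
  have : ξ * (1 - ξ) ≠ 0 := (mul_pos (h₀.trans_le hξ.1) (by linarith [hξ.2])).ne'
  exact ContinuousAt.continuousWithinAt (by fun_prop (disch := assumption))

/-- The logarithm cancels against the squares in `L` and `M`. -/
lemma neg_Lk_add_log_add_Mk_F3 (m : Fin 3) {η : ℝ} (h₀ : 0 < η) (h₁ : η ≤ 1 / 2) :
    -Lk 3 (1 / 2) η m F3 + 1 / 4 * Real.log ((1 - η) / η) * Jk 3 m F3 + Mk 3 (1 / 2) η m F3 =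
      ∫ ξ in η..(1 / 2), 1 / 4 * (ξ ^ 2 * defectPoly ξ) * (1 / (ξ * (1 - ξ))) := by
  have hL : Continuous fun ξ : ℝ => 1 / 2 * sliceEnergy (1 - 2 * ξ) 1 := by
    unfold sliceEnergy triangleMoment
    fun_prop
  have hM : Continuous fun ξ : ℝ => 1 / 4 * sliceEnergy (1 - 2 * ξ) (1 - 2 * ξ) := by
    unfold sliceEnergy triangleMoment
    fun_prop
  have hL' := intervalIntegrable_mul_one_div_mul_one_sub hL h₀ h₁
  have hM' := intervalIntegrable_mul_one_div_mul_one_sub hM h₀ h₁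
  have hJ' := intervalIntegrable_mul_one_div_mul_one_sub
    (continuous_const (y := 1 / 4 * sliceEnergy 1 1)) h₀ h₁
  rw [Lk_F3 m h₀.le h₁, Mk_F3 m h₀.le h₁, Jk_F3, ← integral_one_div_mul_one_sub h₀ h₁,
    mul_right_comm, ← intervalIntegral.integral_const_mul, neg_add_eq_sub,
    ← intervalIntegral.integral_sub hJ' hL', ← intervalIntegral.integral_add (hJ'.sub hL') hM']
  refine integral_congr fun ξ _ => ?_
  simp only [← sliceEnergy_defect]
  ring

lemma integral_defect_lower_bound {η : ℝ} (h₀ : 0 < η) (h₁ : η ≤ 1 / 2) :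
    1 / 4 * ∫ x in η..(1 / 2), x * (1 + x + x ^ 2) * defectPoly x ≤
      ∫ ξ in η..(1 / 2), 1 / 4 * (ξ ^ 2 * defectPoly ξ) * (1 / (ξ * (1 - ξ))) := by
  have hq : Continuous defectPoly := by
    unfold defectPoly
    fun_prop
  rw [← intervalIntegral.integral_const_mul]
  refine intervalIntegral.integral_mono_on h₁ (Continuous.intervalIntegrable (by fun_prop) _ _)
    (intervalIntegrable_mul_one_div_mul_one_sub (by fun_prop) h₀ h₁) fun ξ hξ => ?_
  have hξ₀ : 0 < ξ := h₀.trans_le hξ.1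
  have hξ₁ : 0 < 1 - ξ := by linarith [hξ.2]
  have hgeom : 1 + ξ + ξ ^ 2 ≤ 1 / (1 - ξ) := by
    rw [le_div_iff₀ hξ₁]
    nlinarith [pow_pos hξ₀ 3]
  calc 1 / 4 * (ξ * (1 + ξ + ξ ^ 2) * defectPoly ξ)
      = 1 / 4 * ξ * defectPoly ξ * (1 + ξ + ξ ^ 2) := by ring
    _ ≤ 1 / 4 * ξ * defectPoly ξ * (1 / (1 - ξ)) := by
        have := defectPoly_nonneg hξ₀.le hξ.2
        gcongr
    _ = _ := by field_simp

/-- The key positivity from the proof of Theorem 1.3: with `k = 3`, `θ = 1`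
(`θ/2 = 1/2`) and `η = 10⁻¹⁰`,
`-Σ_m L₃^{(m)}(F) + (1/4)(1 + log((1-η)/η)) Σ_m J₃^{(m)}(F) + Σ_m M₃^{(m)}(F)
 - I₃(F) > 0`. -/
theorem positivity_for_P2_triples :
    0 < -(∑ m : Fin 3, Lk 3 (1 / 2) (1 / 10 ^ 10) m F3)
        + 1 / 4 * (1 + Real.log ((1 - 1 / 10 ^ 10) / (1 / 10 ^ 10)))
          * (∑ m : Fin 3, Jk 3 m F3)
        + (∑ m : Fin 3, Mk 3 (1 / 2) (1 / 10 ^ 10) m F3)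
        - 2 * (1 / 2) * Ik 3 F3 := by
  have h₀ : (0 : ℝ) < 1 / 10 ^ 10 := by positivity
  have h₁ : (1 / 10 ^ 10 : ℝ) ≤ 1 / 2 := by norm_num
  have hbound (m : Fin 3) := (integral_defect_lower_bound h₀ h₁).trans_eq
    (neg_Lk_add_log_add_Mk_F3 m h₀ h₁).symm
  have b₀ := hbound 0
  have b₁ := hbound 1
  have b₂ := hbound 2
  have hnum : 0 < 3 / 4 * (∫ x in (1 / 10 ^ 10 : ℝ)..(1 / 2), x * (1 + x + x ^ 2) * defectPoly x)
      + 3 / 4 * sliceEnergy 1 1 - (triangleMoment 0 1 - triangleMoment 3 1) / 3 := by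
    rw [integral_defect_minorant]
    norm_num [defectPrimitive, sliceEnergy, triangleMoment]
  simp only [Jk_F3] at b₀ b₁ b₂
  simp only [Fin.sum_univ_three, Jk_F3, Ik_F3]
  linarith
end
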